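/- Let (X,d) be compact metric with homeomorphism T, suppose there is a factor map π: (X,T) → (Z,S) onto an aperiodic zero-dimensional system, and mdim(X,T) < D/2 for a positive integer D. Then for every continuous f: X → [0,1]^D, every δ > 0 and η > 0, there exists a continuous g: X → [0,1]^D with ‖f(x) − g(x)‖_∞ < δ for all x, such that the map x ↦ (I_g(x), π(x)) ∈ ([0,1]^D)^ℤ × Z is an η-embedding with respect to d. -/

import Mathlib

open scoped ENNReal NNReal
open Set Function Filter Topology

/-- The `n`-th iterate (`n ∈ ℤ`) of a homeomorphism. -/
noncomputable def hIter {X : Type*} [TopologicalSpace X] (T : X ≃ₜ X) (n : ℤ) (x : X) : X :=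
  if 0 ≤ n then (⇑T)^[n.toNat] x else (⇑T.symm)^[(-n).toNat] x

/-- `WidimLE d ε n`: there is a finite open cover of mesh `< ε` (w.r.t. the distance
function `d`) and of order `≤ n`, i.e. every point lies in at most `n+1` members
(equivalently any `n+2` distinct members have empty intersection). -/
def WidimLE {X : Type*} [TopologicalSpace X] (d : X → X → ℝ) (ε : ℝ) (n : ℕ) : Prop :=
  ∃ (N : ℕ) (U : Fin N → Set X),
    (∀ i, IsOpen (U i)) ∧ (⋃ i, U i) = Set.univ ∧
    (∀ i, ∀ x ∈ U i, ∀ y ∈ U i, d x y < ε) ∧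
    (∀ x : X, ({i | x ∈ U i} : Set (Fin N)).ncard ≤ n + 1)

/-- `widim d ε` : the ε-width dimension with respect to the distance function `d`. -/
noncomputable def widim {X : Type*} [TopologicalSpace X] (d : X → X → ℝ) (ε : ℝ) : ℝ≥0∞ :=
  sInf {c : ℝ≥0∞ | ∃ n : ℕ, c = n ∧ WidimLE d ε n}

/-- `dynDist T n` is the dynamical distance `d_0^{n-1}(x,y) = max_{0 ≤ i < n} d(T^i x, T^i y)`. -/
noncomputable def dynDist {X : Type*} [PseudoMetricSpace X] (T : X → X) (n : ℕ) (x y : X) : ℝ :=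
  (((Finset.range n).sup fun i => nndist (T^[i] x) (T^[i] y)) : ℝ≥0)

/-- Mean dimension `mdim(X,T) = sup_{ε>0} lim_n widim_ε(X, d_0^{n-1})/n`
(the limit exists, so it coincides with the limsup used here). -/
noncomputable def mdim {X : Type*} [MetricSpace X] (T : X → X) : ℝ≥0∞ :=
  ⨆ (ε : ℝ) (_ : 0 < ε), Filter.atTop.limsup fun n : ℕ => widim (dynDist T n) ε / (n : ℝ≥0∞)

/-- The left shift on `ℤ`-indexed sequences. -/
def shift {A : Type*} (x : ℤ → A) : ℤ → A := fun n => x (n + 1)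

section GeneralPosition

open MeasureTheory Module

variable {E : Type*} [NormedAddCommGroup E] [NormedSpace ℝ E] [FiniteDimensional ℝ E]

theorem exists_mem_notMem_affineSpan {O : Set E} (hO : IsOpen O) (hne : O.Nonempty)
    {N : ℕ} (v : Fin N → E) :
    ∃ w ∈ O, ∀ s : Finset (Fin N), s.card ≤ finrank ℝ E →
      w ∉ affineSpan ℝ (Set.range fun i : s => v i) := by
  borelize E
  let μ : Measure E := Measure.addHaar
  have hnull : μ (⋃ s ∈ {s : Finset (Fin N) | s.card ≤ finrank ℝ E},
      (affineSpan ℝ (Set.range fun i : s => v i) : Set E)) = 0 := by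
    refine (measure_biUnion_null_iff (Set.to_countable _)).2 fun s hs => ?_
    refine Measure.addHaar_affineSubspace μ _ fun htop => ?_
    have hdim := AffineSubspace.vectorSpan_eq_top_of_affineSpan_eq_top ℝ E E htop
    rcases Nat.eq_zero_or_pos s.card with h0 | hpos
    · rw [Finset.card_eq_zero] at h0
      subst h0
      have : (0 : E) ∈ (affineSpan ℝ (Set.range fun i : (∅ : Finset (Fin N)) => v i)) := by
        rw [htop]; trivial
      rw [Set.range_eq_empty, AffineSubspace.span_empty] at this
      exact AffineSubspace.notMem_bot ℝ E _ this
    · have hle := finrank_vectorSpan_range_le ℝ (fun i : s => v i) (n := s.card - 1)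
        (by rw [Fintype.card_coe]; omega)
      rw [hdim, finrank_top] at hle
      have : s.card ≤ finrank ℝ E := hs
      omega
  have hpos : 0 < μ O := hO.measure_pos μ hne
  obtain ⟨w, hwO, hw⟩ : (O \ ⋃ s ∈ {s : Finset (Fin N) | s.card ≤ finrank ℝ E},
      (affineSpan ℝ (Set.range fun i : s => v i) : Set E)).Nonempty := by
    rw [Set.nonempty_iff_ne_empty]
    intro h
    exact hpos.ne' (measure_mono_null (Set.sdiff_eq_empty.1 h) hnull)
  refine ⟨w, hwO, fun s hs hmem => hw ?_⟩
  exact Set.mem_biUnion (show s ∈ {s : Finset (Fin N) | s.card ≤ finrank ℝ E} from hs) hmem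

/-- Points in general position can be chosen in prescribed nonempty open sets: among them,
at most `finrank ℝ E + 1` points are always affinely independent. -/
theorem exists_general_position {N : ℕ} (O : Fin N → Set E) (hO : ∀ i, IsOpen (O i))
    (hne : ∀ i, (O i).Nonempty) :
    ∃ v : Fin N → E, (∀ i, v i ∈ O i) ∧ ∀ a : Fin N → ℝ,
      (Finset.univ.filter fun i => a i ≠ 0).card ≤ finrank ℝ E + 1 →
      ∑ i, a i = 0 → ∑ i, a i • v i = 0 → ∀ i, a i = 0 := by
  induction N with
  | zero => exact ⟨fun i => i.elim0, fun i => i.elim0, fun _ _ _ _ i => i.elim0⟩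
  | succ N ih =>
    obtain ⟨v, hvO, hv⟩ := ih (fun i => O i.succ) (fun i => hO _) (fun i => hne _)
    obtain ⟨w, hwO, hw⟩ := exists_mem_notMem_affineSpan (hO 0) (hne 0) v
    refine ⟨Fin.cons w v, Fin.cases hwO hvO, fun a hcard hsum hcomb => ?_⟩
    rw [Fin.card_filter_univ_succ] at hcard
    rw [Fin.sum_univ_succ] at hsum hcomb
    simp only [Fin.cons_zero, Fin.cons_succ] at hcomb
    have h0 : a 0 = 0 := by
      by_contra h0
      rw [if_pos h0] at hcard
      let s : Finset (Fin N) := Finset.univ.filter fun i => a i.succ ≠ 0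
      refine hw s (by simpa [s] using hcard) ?_
      let c : Fin N → ℝ := fun i => -(a 0)⁻¹ * a i.succ
      have hout : ∀ i ∉ s, c i = 0 := fun i hi => by
        have : a i.succ = 0 := by simpa [s] using hi
        simp [c, this]
      have hc : ∑ i : s, c i = 1 := by
        rw [Finset.sum_coe_sort s c,
          Finset.sum_subset (Finset.subset_univ s) fun i _ hi => hout i hi,
          ← Finset.mul_sum, show ∑ i : Fin N, a i.succ = -a 0 by linarith]
        field_simp
      have hcw : ∑ i : s, c i • v i = w := by
        rw [Finset.sum_coe_sort s fun i => c i • v i,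
          Finset.sum_subset (Finset.subset_univ s) fun i _ hi => by rw [hout i hi, zero_smul]]
        simp only [c, mul_smul]
        rw [← Finset.smul_sum,
          show ∑ i : Fin N, a i.succ • v i = -(a 0 • w) from
            eq_neg_of_add_eq_zero_right hcomb, smul_neg, neg_smul, neg_neg, smul_smul,
          inv_mul_cancel₀ h0, one_smul]
      have := affineCombination_mem_affineSpan (s := Finset.univ) hc fun i : s => v i
      rwa [Finset.affineCombination_eq_linear_combination _ _ _ hc, hcw] at this
    rw [if_neg (by simpa using h0)] at hcard
    rw [h0, zero_add] at hsum
    rw [h0, zero_smul, zero_add] at hcomb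
    exact Fin.cases h0 (hv (fun i => a i.succ) hcard hsum hcomb)

/-- A map `h` into a convex body of dimension at least `2 * m + 1`, nearly constant at scale `ε`,
is approximated by continuous maps whose fibres have `d`-diameter less than `ε`, as soon as
the `ε`-width dimension is at most `m`. -/
theorem WidimLE.exists_continuous_approx {X : Type*} [TopologicalSpace X] [NormalSpace X]
    [ParacompactSpace X] {d : X → X → ℝ} {ε δ : ℝ} {m : ℕ} (hw : WidimLE d ε m) (hδ : 0 < δ)
    (hm : 2 * m + 1 ≤ finrank ℝ E) {K : Set E} (hK : Convex ℝ K) (hint : (interior K).Nonempty)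
    (h : X → E) (hhK : ∀ x, h x ∈ K) (hh : ∀ x y, d x y < ε → dist (h x) (h y) < δ / 2) :
    ∃ F : X → E, Continuous F ∧ (∀ x, F x ∈ K) ∧ (∀ x, dist (F x) (h x) < δ) ∧
      ∀ x y, F x = F y → d x y < ε := by
  obtain ⟨N, U, hUo, hUc, hUd, hUm⟩ := hw
  have hp : ∀ i, ∃ p ∈ K, ∀ x ∈ U i, dist p (h x) < δ / 2 := fun i => by
    rcases (U i).eq_empty_or_nonempty with he | ⟨z, hz⟩
    · exact ⟨_, interior_subset hint.some_mem, by simp [he]⟩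
    · exact ⟨h z, hhK z, fun x hx => hh _ _ (hUd i z hz x hx)⟩
  choose p hpK hpd using hp
  obtain ⟨v, hvO, hv⟩ := exists_general_position
    (fun i => Metric.ball (p i) (δ / 2) ∩ interior K)
    (fun i => Metric.isOpen_ball.inter isOpen_interior) fun i => by
      have : p i ∈ closure (interior K) := by
        rw [hK.closure_interior_eq_closure_of_nonempty_interior hint]
        exact subset_closure (hpK i)
      exact mem_closure_iff.1 this _ Metric.isOpen_ball (Metric.mem_ball_self (by positivity))
  obtain ⟨φ, hφ⟩ := PartitionOfUnity.exists_isSubordinate isClosed_univ U hUo hUc.ge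
  have hφU : ∀ i x, φ i x ≠ 0 → x ∈ U i := fun i x hx => hφ i (subset_tsupport _ hx)
  have hφ1 : ∀ x, ∑ i, φ i x = 1 := fun x => by
    rw [← finsum_eq_sum_of_fintype]; exact φ.sum_eq_one (Set.mem_univ x)
  have hconv : ∀ x (t : Set E), Convex ℝ t → (∀ i, x ∈ U i → v i ∈ t) →
      ∑ i, φ i x • v i ∈ t := fun x t ht hvt => by
    rw [← finsum_eq_sum_of_fintype]
    exact φ.finsum_smul_mem_convex (g := fun i _ => v i) (Set.mem_univ x)
      (fun i hi => hvt i (hφU i x hi)) ht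
  refine ⟨fun x => ∑ i, φ i x • v i, by fun_prop, fun x => ?_, fun x => ?_, fun x y hxy => ?_⟩
  · exact hconv x K hK fun i _ => interior_subset (hvO i).2
  · refine hconv x _ (convex_ball (h x) δ) fun i hi => ?_
    have h1 := hpd i x hi
    have h2 : dist (v i) (p i) < δ / 2 := (hvO i).1
    have h3 := dist_triangle (v i) (p i) (h x)
    rw [Metric.mem_ball]
    linarith
  · have hcard : (Finset.univ.filter fun i => φ i x - φ i y ≠ 0).card ≤ finrank ℝ E + 1 := by
      classical
      have hb : ∀ z, (Finset.univ.filter fun i => z ∈ U i).card ≤ m + 1 := fun z => by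
        have := hUm z
        rwa [Set.ncard_eq_toFinset_card', Set.toFinset_ofPred] at this
      have hsub : (Finset.univ.filter fun i => φ i x - φ i y ≠ 0) ⊆
          (Finset.univ.filter fun i => x ∈ U i) ∪ Finset.univ.filter fun i => y ∈ U i := by
        intro i hi
        simp only [Finset.mem_filter, Finset.mem_univ, true_and, Finset.mem_union] at hi ⊢
        by_contra! hn
        have hx0 : φ i x = 0 := by_contra fun hx => hn.1 (hφU i x hx)
        have hy0 : φ i y = 0 := by_contra fun hy => hn.2 (hφU i y hy)
        exact hi (by rw [hx0, hy0, sub_zero])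
      have := (Finset.card_le_card hsub).trans (Finset.card_union_le _ _)
      have := hb x
      have := hb y
      omega
    have heq := hv (fun i => φ i x - φ i y) hcard
      (by rw [Finset.sum_sub_distrib, hφ1, hφ1, sub_self])
      (by simp only [sub_smul]; rw [Finset.sum_sub_distrib]; exact sub_eq_zero.2 hxy)
    obtain ⟨i, -, hi⟩ : ∃ i ∈ Finset.univ, φ i x ≠ 0 :=
      Finset.exists_ne_zero_of_sum_ne_zero (by rw [hφ1]; exact one_ne_zero)
    exact hUd i x (hφU i x hi) y (hφU i y (by rwa [← sub_eq_zero.1 (heq i)]))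

end GeneralPosition

section Marker

variable {Z : Type*} [TopologicalSpace Z]

/-- An aperiodic homeomorphism of a totally disconnected compact space has clopen markers:
a clopen set that is disjoint from its first `N - 1` images and meets every orbit. -/
theorem exists_clopen_marker [CompactSpace Z] [T2Space Z] [TotallyDisconnectedSpace Z]
    (S : Z ≃ₜ Z) (hap : ∀ (z : Z) (n : ℕ), 0 < n → (⇑S)^[n] z ≠ z) (N : ℕ) (hN : 0 < N) :
    ∃ U : Set Z, IsClopen U ∧ (∀ z ∈ U, ∀ n : ℤ, 0 < n → n < N → (S ^ n) z ∉ U) ∧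
      ∀ z, ∃ n ∈ Set.Ioo (-(N : ℤ)) N, (S ^ n) z ∈ U := by
  have hV : ∀ z : Z, ∃ V : Set Z, IsClopen V ∧ z ∈ V ∧
      ∀ w ∈ V, ∀ n : ℤ, 0 < n → n < N → (S ^ n) w ∉ V := fun z => by
    have hC : ∀ n : ℕ, ∃ C : Set Z, IsClopen C ∧ z ∈ C ∧
        (0 < n → ∀ w ∈ C, (S ^ n) w ∉ C) := fun n => by
      rcases Nat.eq_zero_or_pos n with rfl | hn
      · exact ⟨Set.univ, isClopen_univ, trivial, fun h => absurd h (lt_irrefl 0)⟩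
      · have hne : z ≠ (S ^ n) z := by
          rw [show ⇑(S ^ n) = (⇑S)^[n] from hom_coe_pow DFunLike.coe rfl (fun _ _ => rfl) S n]
          exact (hap z n hn).symm
        obtain ⟨C, hC, hzC, hnC⟩ := exists_isClopen_of_totally_separated hne
        exact ⟨C \ (S ^ n) ⁻¹' C, hC.diff (hC.preimage (S ^ n).continuous), ⟨hzC, hnC⟩,
          fun _ w hw hw' => hw.2 hw'.1⟩
    choose C hC hzC hCn using hC
    refine ⟨⋂ n : Fin N, C n, isClopen_iInter_of_finite fun n => hC n,
      Set.mem_iInter.2 fun n => hzC n, fun w hw n hn hnN hSw => ?_⟩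
    lift n to ℕ using hn.le
    rw [zpow_natCast] at hSw
    have hnN' : n < N := by exact_mod_cast hnN
    exact hCn n (by exact_mod_cast hn) w (Set.mem_iInter.1 hw ⟨n, hnN'⟩)
      (Set.mem_iInter.1 hSw ⟨n, hnN'⟩)
  choose V hVc hzV hVn using hV
  obtain ⟨t, ht⟩ := CompactSpace.elim_nhds_subcover V
    fun z => (hVc z).isOpen.mem_nhds (hzV z)
  have key : ∀ t : Finset Z, ∃ U : Set Z, IsClopen U ∧
      (∀ z ∈ U, ∀ n : ℤ, 0 < n → n < N → (S ^ n) z ∉ U) ∧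
      ∀ i ∈ t, ∀ z ∈ V i, ∃ n ∈ Set.Ioo (-(N : ℤ)) N, (S ^ n) z ∈ U := fun t => by
    classical
    induction t using Finset.induction_on with
    | empty => exact ⟨∅, isClopen_empty, by simp, by simp⟩
    | insert i t _ ih =>
      obtain ⟨U, hU, hUn, hUt⟩ := ih
      let W : Set Z := ⋃ n : Set.Ioo (-(N : ℤ)) N, (S ^ (n : ℤ)) ⁻¹' U
      have hW : IsClopen W :=
        isClopen_iUnion_of_finite fun n => hU.preimage (S ^ (n : ℤ)).continuous
      have hWm : ∀ z (n : ℤ), -(N : ℤ) < n → n < N → (S ^ n) z ∈ U → z ∈ W :=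
        fun z n h1 h2 h3 => Set.mem_iUnion.2 ⟨⟨n, h1, h2⟩, h3⟩
      refine ⟨U ∪ (V i \ W), hU.union ((hVc i).diff hW), ?_, ?_⟩
      · rintro z (hz | hz) n hn hnN (hn' | hn')
        · exact hUn z hz n hn hnN hn'
        · refine hn'.2 (hWm _ (-n) (by omega) (by omega) ?_)
          rwa [← Homeomorph.mul_apply, ← zpow_add, neg_add_cancel]
        · exact hz.2 (hWm z n (by omega) hnN hn')
        · exact hVn i z hz.1 n hn hnN hn'.1
      · intro j hj z hz
        rcases Finset.mem_insert.1 hj with rfl | hj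
        · by_cases hzW : z ∈ W
          · obtain ⟨n, hn⟩ := Set.mem_iUnion.1 hzW
            exact ⟨n, n.2, Or.inl hn⟩
          · exact ⟨0, ⟨by omega, by omega⟩, Or.inr ⟨hz, hzW⟩⟩
        · obtain ⟨n, hn, hnU⟩ := hUt j hj z hz
          exact ⟨n, hn, Or.inl hnU⟩
  obtain ⟨U, hU, hUn, hUt⟩ := key t
  refine ⟨U, hU, hUn, fun z => ?_⟩
  have hz : z ∈ ⋃ x ∈ t, V x := by rw [ht]; trivial
  obtain ⟨i, hi, hzi⟩ := Set.mem_iUnion₂.1 hz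
  exact hUt i hi z hzi

theorem continuous_find_of_isClopen {P : ℕ → Z → Prop} [∀ z, DecidablePred fun n => P n z]
    (hP : ∀ n, IsClopen {z | P n z}) (hex : ∀ z, ∃ n, P n z) :
    Continuous fun z => Nat.find (hex z) := by
  refine continuous_discrete_rng.2 fun k => ?_
  have : (fun z => Nat.find (hex z)) ⁻¹' {k} =
      {z | P k z} ∩ ⋂ n : Fin k, {z | P n z}ᶜ := by
    ext z
    simp only [Set.mem_preimage, Set.mem_singleton_iff, Nat.find_eq_iff, Set.mem_inter_iff,
      Set.mem_iInter, Set.mem_compl_iff, Set.mem_ofPred_eq]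
    exact and_congr_right fun _ => ⟨fun h n => h n n.2, fun h n hn => h ⟨n, hn⟩⟩
  rw [this]
  exact ((hP k).inter (isClopen_iInter_of_finite fun n : Fin k => (hP n).compl)).isOpen

/-- A partition into clopen Rokhlin towers of heights at least `N`: `r z` is the height of the
tower containing `z` and `b z` the level of `z` in it. -/
theorem exists_clopen_towers [CompactSpace Z] [T2Space Z] [TotallyDisconnectedSpace Z]
    (S : Z ≃ₜ Z) (hap : ∀ (z : Z) (n : ℕ), 0 < n → (⇑S)^[n] z ≠ z) (N : ℕ) (hN : 0 < N) :
    ∃ r b : Z → ℕ, Continuous r ∧ Continuous b ∧ (∀ z, N ≤ r z) ∧ (∀ z, b z < r z) ∧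
      ∀ z, ∀ j < r z, r ((S ^ ((j : ℤ) - b z)) z) = r z ∧ b ((S ^ ((j : ℤ) - b z)) z) = j := by
  classical
  obtain ⟨U, hU, hUn, hUc⟩ := exists_clopen_marker S hap N hN
  have hadd : ∀ (m n : ℤ) z, (S ^ m) ((S ^ n) z) = (S ^ (m + n)) z := fun m n z => by
    rw [zpow_add, Homeomorph.mul_apply]
  have hb : ∀ z, ∃ n : ℕ, (S ^ (-(n : ℤ))) z ∈ U := fun z => by
    obtain ⟨n, ⟨hn1, hn2⟩, hn⟩ := hUc ((S ^ (-(N : ℤ))) z)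
    refine ⟨(N - n).toNat, ?_⟩
    rw [hadd] at hn
    rwa [show -((N - n).toNat : ℤ) = n + -N by omega]
  have ha : ∀ z, ∃ n : ℕ, (S ^ ((n : ℤ) + 1)) z ∈ U := fun z => by
    obtain ⟨n, ⟨hn1, hn2⟩, hn⟩ := hUc ((S ^ (N : ℤ)) z)
    refine ⟨(N + n - 1).toNat, ?_⟩
    rw [hadd] at hn
    rwa [show ((N + n - 1).toNat : ℤ) + 1 = n + N by omega]
  refine ⟨fun z => Nat.find (hb z) + (Nat.find (ha z) + 1), fun z => Nat.find (hb z),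
    (continuous_find_of_isClopen (fun n => hU.preimage (S ^ (-(n : ℤ))).continuous) hb).add
      ((continuous_find_of_isClopen
        (fun n => hU.preimage (S ^ ((n : ℤ) + 1)).continuous) ha).add continuous_const),
    continuous_find_of_isClopen (fun n => hU.preimage (S ^ (-(n : ℤ))).continuous) hb,
    fun z => ?_, fun z => by beta_reduce; omega, fun z j hj => ?_⟩
  · beta_reduce
    by_contra! hlt
    refine hUn _ (Nat.find_spec (hb z)) (Nat.find (hb z) + (Nat.find (ha z) + 1) : ℕ)
      (by omega) (by omega) ?_
    rw [hadd]
    convert Nat.find_spec (ha z) using 3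
    push_cast
    ring
  · beta_reduce at hj ⊢
    have hbs := Nat.find_spec (hb z)
    have has := Nat.find_spec (ha z)
    have hbm : ∀ n : ℕ, n < Nat.find (hb z) → (S ^ (-(n : ℤ))) z ∉ U :=
      fun n hn => Nat.find_min (hb z) hn
    have ham : ∀ n : ℕ, n < Nat.find (ha z) → (S ^ ((n : ℤ) + 1)) z ∉ U :=
      fun n hn => Nat.find_min (ha z) hn
    set β := Nat.find (hb z)
    set α := Nat.find (ha z)
    have hmid : ∀ k : ℤ, -(β : ℤ) < k → k < α + 1 → (S ^ k) z ∉ U := fun k h1 h2 => by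
      rcases le_or_gt k 0 with hk | hk
      · rw [show k = -(k.natAbs : ℤ) by omega]
        exact hbm _ (by omega)
      · rw [show k = ((k - 1).toNat : ℤ) + 1 by omega]
        exact ham _ (by omega)
    have hj' : Nat.find (hb ((S ^ ((j : ℤ) - β)) z)) = j := by
      rw [Nat.find_eq_iff]
      refine ⟨?_, fun n hn => ?_⟩
      · rwa [hadd, show -(j : ℤ) + (j - β) = -β by ring]
      · rw [hadd]
        exact hmid _ (by omega) (by omega)
    have ha' : Nat.find (ha ((S ^ ((j : ℤ) - β)) z)) = β + α - j := by
      rw [Nat.find_eq_iff]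
      refine ⟨?_, fun n hn => ?_⟩
      · rwa [hadd, show ((β + α - j : ℕ) : ℤ) + 1 + (j - β) = α + 1 by omega]
      · rw [hadd]
        exact hmid _ (by omega) (by omega)
    refine ⟨?_, hj'⟩
    rw [hj', ha']
    omega

end Marker

theorem hIter_eq_zpow {X : Type*} [TopologicalSpace X] (T : X ≃ₜ X) (n : ℤ) (x : X) :
    hIter T n x = (T ^ n) x := by
  have hpow : ∀ (R : X ≃ₜ X) (k : ℕ), (⇑R)^[k] = ⇑(R ^ k) := fun R k =>
    (hom_coe_pow DFunLike.coe rfl (fun _ _ => rfl) R k).symm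
  unfold hIter
  split_ifs with h
  · rw [hpow, ← zpow_natCast, Int.toNat_of_nonneg h]
  · rw [hpow, ← zpow_natCast, Int.toNat_of_nonneg (by omega), show T.symm = T⁻¹ from rfl,
      inv_zpow', neg_neg]

theorem semiconj_zpow {X Z : Type*} [TopologicalSpace X] [TopologicalSpace Z] {T : X ≃ₜ X}
    {S : Z ≃ₜ Z} {π : X → Z} (h : ∀ x, π (T x) = S (π x)) (n : ℤ) (x : X) :
    π ((T ^ n) x) = (S ^ n) (π x) := by
  have hinv : ∀ x, π (T⁻¹ x) = S⁻¹ (π x) := fun x => by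
    rw [Homeomorph.inv_apply, Homeomorph.inv_apply, Homeomorph.eq_symm_apply, ← h,
      Homeomorph.apply_symm_apply]
  induction n generalizing x with
  | zero => rfl
  | succ n ih => rw [zpow_add_one, zpow_add_one, Homeomorph.mul_apply, ih, h, Homeomorph.mul_apply]
  | pred n ih =>
    rw [zpow_sub_one, zpow_sub_one, Homeomorph.mul_apply, ih, hinv, Homeomorph.mul_apply]

theorem dist_iterate_le_dynDist {X : Type*} [PseudoMetricSpace X] (T : X → X) {n k : ℕ}
    (hk : k < n) (x y : X) : dist (T^[k] x) (T^[k] y) ≤ dynDist T n x y := by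
  unfold dynDist
  rw [← coe_nndist, NNReal.coe_le_coe]
  exact Finset.le_sup (f := fun i => nndist (T^[i] x) (T^[i] y)) (Finset.mem_range.2 hk)

/-- A bound on the mean dimension yields bounds on the width dimensions of long orbit
segments. -/
theorem exists_widimLE_of_mdim_lt {X : Type*} [MetricSpace X] {T : X → X} {D : ℕ}
    (h : mdim T < (D : ℝ≥0∞) / 2) {ε : ℝ} (hε : 0 < ε) :
    ∃ N, 0 < N ∧ ∀ n ≥ N, ∃ m, WidimLE (dynDist T n) ε m ∧ 2 * m + 1 ≤ n * D := by
  have hlim : atTop.limsup (fun n : ℕ => widim (dynDist T n) ε / (n : ℝ≥0∞)) <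
      (D : ℝ≥0∞) / 2 :=
    (le_iSup₂ (f := fun (ε : ℝ) (_ : 0 < ε) =>
      atTop.limsup fun n : ℕ => widim (dynDist T n) ε / (n : ℝ≥0∞)) ε hε).trans_lt h
  obtain ⟨N, hN⟩ := eventually_atTop.1 (eventually_lt_of_limsup_lt hlim)
  refine ⟨N + 1, N.succ_pos, fun n hn => ?_⟩
  have h1 := hN n (by omega)
  have hn0 : (n : ℝ≥0∞) ≠ 0 := by
    rw [Nat.cast_ne_zero]; omega
  rw [ENNReal.div_lt_iff (Or.inl hn0) (Or.inl (ENNReal.natCast_ne_top n))] at h1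
  obtain ⟨_, ⟨m, rfl, hm⟩, hlt⟩ := sInf_lt_iff.1 h1
  refine ⟨m, hm, ?_⟩
  rw [div_eq_mul_inv, mul_right_comm, ← div_eq_mul_inv,
    ENNReal.lt_div_iff_mul_lt (Or.inl two_ne_zero) (Or.inl ENNReal.ofNat_ne_top)] at hlt
  have : m * 2 < D * n := by exact_mod_cast hlt
  linarith

/-- Perturbing the initial segment of length `r` of the itinerary `I_f` to an
`ε`-embedding for the dynamical distance. -/
theorem exists_itinerary_approx {X : Type*} [MetricSpace X] [CompactSpace X] {T : X → X}
    {D r m : ℕ} {ε δ : ℝ} (hδ : 0 < δ) (hw : WidimLE (dynDist T r) ε m)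
    (hm : 2 * m + 1 ≤ r * D) (f : X → Fin D → ℝ) (hfc : ∀ x i, f x i ∈ Set.Icc (0 : ℝ) 1)
    (hfε : ∀ x y, dist x y < ε → dist (f x) (f y) < δ / 4) :
    ∃ F : X → ℕ → Fin D → ℝ, (∀ k, Continuous fun x => F x k) ∧
      (∀ x, ∀ k < r, (∀ i, F x k i ∈ Set.Icc (0 : ℝ) 1) ∧ ‖f (T^[k] x) - F x k‖ < δ) ∧
      ∀ x y, (∀ k < r, F x k = F y k) → dynDist T r x y < ε := by
  have hint : (interior (Set.Icc (0 : Fin r → Fin D → ℝ) 1)).Nonempty := by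
    refine ⟨fun _ _ => 1 / 2, mem_interior.2 ⟨Metric.ball _ (1 / 2), fun w hw => ?_,
      Metric.isOpen_ball, Metric.mem_ball_self (by norm_num)⟩⟩
    have hw' : ∀ k i, |w k i - 1 / 2| < 1 / 2 := fun k i => by
      rw [← Real.dist_eq]
      exact ((dist_le_pi_dist (w k) _ i).trans (dist_le_pi_dist w _ k)).trans_lt hw
    exact ⟨fun k i => by have := abs_lt.1 (hw' k i); simp only [Pi.zero_apply]; linarith,
      fun k i => by have := abs_lt.1 (hw' k i); simp only [Pi.one_apply]; linarith⟩
  obtain ⟨F, hFc, hFK, hFd, hFe⟩ := hw.exists_continuous_approx hδ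
    (E := Fin r → Fin D → ℝ) (by simpa [Module.finrank_pi_fintype] using hm) (convex_Icc 0 1) hint
    (fun x k => f (T^[k] x))
    (fun x => ⟨fun k i => (hfc _ i).1, fun k i => (hfc _ i).2⟩)
    (fun x y hxy => by
      refine lt_of_le_of_lt ((dist_pi_le_iff (by positivity)).2 fun k => ?_)
        (by linarith : δ / 4 < δ / 2)
      exact (hfε _ _ ((dist_iterate_le_dynDist T k.2 x y).trans_lt hxy)).le)
  refine ⟨fun x k => if hk : k < r then F x ⟨k, hk⟩ else 0, fun k => ?_, fun x k hk => ?_,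
    fun x y hxy => hFe x y ?_⟩
  · by_cases hk : k < r
    · simp only [hk, dite_true]; fun_prop
    · simp only [hk, dite_false]; fun_prop
  · simp only [hk, dite_true]
    refine ⟨fun i => ⟨(hFK x).1 ⟨k, hk⟩ i, (hFK x).2 ⟨k, hk⟩ i⟩, ?_⟩
    rw [← dist_eq_norm, dist_comm]
    exact (dist_le_pi_dist (F x) (fun k : Fin r => f (T^[k] x)) ⟨k, hk⟩).trans_lt (hFd x)
  · funext k
    simpa using hxy k k.2

/-- Main perturbation proposition: if `π : (X,T) → (Z,S)` is a factor map onto an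
aperiodic zero-dimensional system and `mdim(X,T) < D/2`, then every continuous
`f : X → [0,1]^D` can be `δ`-perturbed to a continuous `g` such that
`x ↦ (I_g(x), π(x))` is an `η`-embedding: if `g(T^n x) = g(T^n y)` for all `n ∈ ℤ`
and `π x = π y`, then `d(x,y) < η`. -/
theorem stmt7 {X Z : Type*} [MetricSpace X] [CompactSpace X]
    [MetricSpace Z] [CompactSpace Z] [TotallyDisconnectedSpace Z]
    (T : X ≃ₜ X) (S : Z ≃ₜ Z)
    (hap : ∀ (z : Z) (n : ℕ), 0 < n → (⇑S)^[n] z ≠ z)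
    (π : X → Z) (hπc : Continuous π) (hπs : Function.Surjective π)
    (hπe : ∀ x, π (T x) = S (π x))
    (D : ℕ) (hD : 0 < D) (hmdim : mdim ⇑T < (D : ℝ≥0∞) / 2)
    (f : X → Fin D → ℝ) (hf : Continuous f) (hfc : ∀ x i, f x i ∈ Set.Icc (0:ℝ) 1)
    {δ η : ℝ} (hδ : 0 < δ) (hη : 0 < η) :
    ∃ g : X → Fin D → ℝ, Continuous g ∧ (∀ x i, g x i ∈ Set.Icc (0:ℝ) 1) ∧
      (∀ x, ‖f x - g x‖ < δ) ∧
      (∀ x y : X, (∀ n : ℤ, g (hIter T n x) = g (hIter T n y)) → π x = π y →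
        dist x y < η) := by
  obtain ⟨ε₀, hε₀, hfε₀⟩ := Metric.uniformContinuous_iff.1
    (CompactSpace.uniformContinuous_of_continuous hf) (δ / 4) (by positivity)
  let ε := min ε₀ η
  have hε : 0 < ε := lt_min hε₀ hη
  obtain ⟨N, hN, hwid⟩ := exists_widimLE_of_mdim_lt hmdim hε
  obtain ⟨r, b, hr, hb, hNr, hbr, hrb⟩ := exists_clopen_towers S hap N hN
  have hF : ∀ n : ℕ, ∃ F : X → ℕ → Fin D → ℝ, N ≤ n → (∀ k, Continuous fun x => F x k) ∧
      (∀ x, ∀ k < n, (∀ i, F x k i ∈ Set.Icc (0 : ℝ) 1) ∧ ‖f ((⇑T)^[k] x) - F x k‖ < δ) ∧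
      ∀ x y, (∀ k < n, F x k = F y k) → dynDist (⇑T) n x y < ε := fun n => by
    by_cases hn : N ≤ n
    · obtain ⟨m, hm, hmn⟩ := hwid n hn
      obtain ⟨F, hF⟩ := exists_itinerary_approx hδ hm hmn f hfc
        fun x y hxy => hfε₀ (hxy.trans_le (min_le_left _ _))
      exact ⟨F, fun _ => hF⟩
    · exact ⟨0, fun h => absurd h hn⟩
  choose F hF using hF
  have hpow : ∀ k : ℕ, (⇑T)^[k] = ⇑(T ^ (k : ℤ)) := fun k => by
    rw [zpow_natCast]
    exact (hom_coe_pow DFunLike.coe rfl (fun _ _ => rfl) T k).symm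
  have hadd : ∀ (m n : ℤ) x, (T ^ m) ((T ^ n) x) = (T ^ (m + n)) x := fun m n x => by
    rw [zpow_add, Homeomorph.mul_apply]
  have hback : ∀ x, (⇑T)^[b (π x)] ((T ^ (-(b (π x) : ℤ))) x) = x := fun x => by
    rw [hpow, hadd, add_neg_cancel, zpow_zero]
    rfl
  let g : X → Fin D → ℝ := fun x => F (r (π x)) ((T ^ (-(b (π x) : ℤ))) x) (b (π x))
  have hg : ∀ x, ∀ j < r (π x), g ((T ^ ((j : ℤ) - b (π x))) x) =
      F (r (π x)) ((T ^ (-(b (π x) : ℤ))) x) j := fun x j hj => by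
    simp only [g]
    rw [semiconj_zpow hπe, (hrb (π x) j hj).1, (hrb (π x) j hj).2, hadd,
      show -(j : ℤ) + (j - b (π x)) = -b (π x) by ring]
  refine ⟨g, ?_, fun x => ?_, fun x => ?_, fun x y hxy hπxy => ?_⟩
  · rw [continuous_iff_continuousAt]
    intro x
    have hloc : ∀ᶠ y in 𝓝 x, g y =
        F (r (π x)) ((T ^ (-(b (π x) : ℤ))) y) (b (π x)) := by
      filter_upwards [(hr.comp hπc).tendsto x ((isOpen_discrete {r (π x)}).mem_nhds rfl),
        (hb.comp hπc).tendsto x ((isOpen_discrete {b (π x)}).mem_nhds rfl)] with y h1 h2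
      simp only [Set.mem_preimage, Function.comp_apply, Set.mem_singleton_iff] at h1 h2
      simp only [g, h1, h2]
    refine ContinuousAt.congr_of_eventuallyEq ?_ hloc
    exact (((hF _ (hNr (π x))).1 _).comp (T ^ (-(b (π x) : ℤ))).continuous).continuousAt
  · exact ((hF _ (hNr (π x))).2.1 _ _ (hbr (π x))).1
  · have := ((hF _ (hNr (π x))).2.1 ((T ^ (-(b (π x) : ℤ))) x) _ (hbr (π x))).2
    rwa [hback] at this
  · have hd : dynDist (⇑T) (r (π x)) ((T ^ (-(b (π x) : ℤ))) x) ((T ^ (-(b (π x) : ℤ))) y) < ε := by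
      refine (hF _ (hNr (π x))).2.2 _ _ fun j hj => ?_
      have h1 := hg x j hj
      have h2 := hg y j (hπxy ▸ hj)
      rw [← hπxy] at h2
      rw [← h1, ← h2, ← hIter_eq_zpow, ← hIter_eq_zpow]
      exact hxy _
    have hle := dist_iterate_le_dynDist (⇑T) (hbr (π x))
      ((T ^ (-(b (π x) : ℤ))) x) ((T ^ (-(b (π x) : ℤ))) y)
    have hy := hback y
    rw [← hπxy] at hy
    rw [hback, hy] at hle
    exact (hle.trans_lt hd).trans_le (min_le_right _ _)
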